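/- Let ∅ ≠ E ⊂ ℝ be a closed set, let D₀ = ℂ \ E and D = D₀ ∩ {z ∈ ℂ : Im z ≥ 0}. Then there is a universal constant δ such that the metric space (D, k_{D₀|D}), where k_{D₀|D} is the inner metric on D obtained from the restriction of the quasihyperbolic metric of D₀, is Gromov δ-hyperbolic. -/

import Mathlib

open Set Metric Filter Complex

noncomputable section

/-- The length of a curve `γ : [0,1] → E` with respect to the conformal density `ρ`. -/
def curveLen {E : Type*} [NormedAddCommGroup E] [NormedSpace ℝ E]
    (ρ : E → ℝ) (γ : ℝ → E) : ℝ :=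
  ∫ t in (0:ℝ)..1, ρ (γ t) * ‖deriv γ t‖

/-- The distance induced on the set `S` by the conformal density `ρ`, defined as the infimum
of the `ρ`-lengths of C¹ curves joining the two points inside `S`. -/
def densityDist {E : Type*} [NormedAddCommGroup E] [NormedSpace ℝ E]
    (S : Set E) (ρ : E → ℝ) (z w : E) : ℝ :=
  sInf { L | ∃ γ : ℝ → E, ContDiffOn ℝ 1 γ (Icc 0 1) ∧ γ 0 = z ∧ γ 1 = w ∧
      (∀ t ∈ Icc (0:ℝ) 1, γ t ∈ S) ∧ L = curveLen ρ γ }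

/-- The quasihyperbolic density `1/δ_Ω(z)` of a domain `Ω`. -/
def qhDensity {E : Type*} [NormedAddCommGroup E] [NormedSpace ℝ E] (Ω : Set E) : E → ℝ :=
  fun z => (Metric.infDist z Ωᶜ)⁻¹

/-- The quasihyperbolic distance of a domain `Ω`. -/
def qhDist {E : Type*} [NormedAddCommGroup E] [NormedSpace ℝ E] (Ω : Set E) : E → E → ℝ :=
  densityDist Ω (qhDensity Ω)

/-- `lam` is the density of the Poincaré (hyperbolic) metric of the plane domain `Ω`:
it is the pushforward of the density `2/(1-|z|²)` of the unit disk under a holomorphic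
universal covering map `p : 𝔻 → Ω`. -/
def IsPoincareDensity (Ω : Set ℂ) (lam : ℂ → ℝ) : Prop :=
  ∃ p : ℂ → ℂ,
    (∀ z ∈ ball (0:ℂ) 1, DifferentiableAt ℂ p z) ∧
    p '' ball (0:ℂ) 1 = Ω ∧
    IsCoveringMapOn (fun z : ball (0:ℂ) 1 => p z) Ω ∧
    ∀ z ∈ ball (0:ℂ) 1, lam (p z) * ‖deriv p z‖ = 2 / (1 - ‖z‖ ^ 2)

/-- `g` is a geodesic in `(S, d)` from `x` to `y`, parametrized by arclength on
`[0, d x y]`. -/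
def IsGeodesicIn {α : Type*} (S : Set α) (d : α → α → ℝ) (g : ℝ → α) (x y : α) : Prop :=
  g 0 = x ∧ g (d x y) = y ∧ (∀ t ∈ Icc (0:ℝ) (d x y), g t ∈ S) ∧
  ∀ s ∈ Icc (0:ℝ) (d x y), ∀ t ∈ Icc (0:ℝ) (d x y), d (g s) (g t) = |s - t|

/-- Every geodesic triangle of `(S, d)` is `δ`-thin (Rips condition). -/
def GromovHyperbolicWith {α : Type*} (S : Set α) (d : α → α → ℝ) (δ : ℝ) : Prop :=
  ∀ x ∈ S, ∀ y ∈ S, ∀ z ∈ S, ∀ gxy gxz gzy : ℝ → α,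
    IsGeodesicIn S d gxy x y → IsGeodesicIn S d gxz x z → IsGeodesicIn S d gzy z y →
    ∀ t ∈ Icc (0:ℝ) (d x y),
      ∃ p ∈ gxz '' Icc (0:ℝ) (d x z) ∪ gzy '' Icc (0:ℝ) (d z y), d (gxy t) p ≤ δ

/-- `(S, d)` is Gromov hyperbolic: some `δ ≥ 0` works for all geodesic triangles. -/
def IsGromovHyperbolic {α : Type*} (S : Set α) (d : α → α → ℝ) : Prop :=
  ∃ δ : ℝ, 0 ≤ δ ∧ GromovHyperbolicWith S d δ

/-- The real axis inside `ℂ`. -/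
def realLine : Set ℂ := {z : ℂ | z.im = 0}

/-- A Denjoy domain: a domain whose boundary is contained in the real axis. -/
def IsDenjoyDomain (Ω : Set ℂ) : Prop :=
  IsOpen Ω ∧ IsConnected Ω ∧ frontier Ω ⊆ realLine

/-- The distance (for the distance function `d`) from a point to a set. -/
def distToSet {α : Type*} (d : α → α → ℝ) (z : α) (A : Set α) : ℝ :=
  sInf (d z '' A)

/-- A fundamental geodesic: a geodesic of `(S, d)` contained in the closed upper half plane,
joining a point of the boundary interval `I` (on the real axis) to a point of the boundary
interval `J`. -/
def IsFundGeodesic (S : Set ℂ) (d : ℂ → ℂ → ℝ) (I J : Set ℝ) (g : ℝ → ℂ) (x y : ℂ) : Prop :=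
  IsGeodesicIn S d g x y ∧ x.im = 0 ∧ x.re ∈ I ∧ y.im = 0 ∧ y.re ∈ J ∧
  ∀ t ∈ Icc (0:ℝ) (d x y), 0 ≤ (g t).im

end

noncomputable section

/-- A nonnegative speed `v` weighted by `1/δ`, where `δ` grows at most as fast as the distance
travelled, has logarithmically large integral. -/
theorem log_one_add_le_integral_inv_mul {v δ : ℝ → ℝ} {a b D : ℝ} (hab : a ≤ b) (hD : 0 < D)
    (hv : Continuous v) (hv0 : ∀ t, 0 ≤ v t) (hδ : ContinuousOn δ (Icc a b))
    (hδ0 : ∀ t ∈ Icc a b, 0 < δ t) (hle : ∀ t ∈ Icc a b, δ t ≤ D + ∫ s in a..t, v s) :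
    Real.log (1 + (∫ s in a..b, v s) / D) ≤ ∫ t in a..b, (δ t)⁻¹ * v t := by
  have hℓ : ∀ t, HasDerivAt (fun t => D + ∫ s in a..t, v s) (v t) t := fun t =>
    ((hv.integral_hasStrictDerivAt a t).hasDerivAt).const_add D
  have hℓ0 : ∀ t ∈ Icc a b, 0 < D + ∫ s in a..t, v s := fun t ht =>
    add_pos_of_pos_of_nonneg hD
      (intervalIntegral.integral_nonneg ht.1 fun s _ => hv0 s)
  have hcont : Continuous fun t => D + ∫ s in a..t, v s :=
    continuous_iff_continuousAt.2 fun t => (hℓ t).continuousAt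
  have hint : IntervalIntegrable (fun t => v t / (D + ∫ s in a..t, v s))
      MeasureTheory.volume a b := by
    apply ContinuousOn.intervalIntegrable
    rw [uIcc_of_le hab]
    exact hv.continuousOn.div hcont.continuousOn fun t ht => (hℓ0 t ht).ne'
  have key : ∫ t in a..b, v t / (D + ∫ s in a..t, v s)
      = Real.log (D + ∫ s in a..b, v s) - Real.log (D + ∫ s in a..a, v s) := by
    apply intervalIntegral.integral_eq_sub_of_hasDerivAt
    · intro t ht
      rw [uIcc_of_le hab] at ht
      exact (hℓ t).log (hℓ0 t ht).ne'
    · exact hint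
  have hb := hℓ0 b (right_mem_Icc.2 hab)
  have e : Real.log (1 + (∫ s in a..b, v s) / D)
      = ∫ t in a..b, v t / (D + ∫ s in a..t, v s) := by
    rw [key, intervalIntegral.integral_same, add_zero, ← Real.log_div hb.ne' hD.ne']
    congr 1
    field_simp
  rw [e]
  apply intervalIntegral.integral_mono_on hab hint
  · apply ContinuousOn.intervalIntegrable
    rw [uIcc_of_le hab]
    exact (hδ.inv₀ fun t ht => (hδ0 t ht).ne').mul hv.continuousOn
  · intro t ht
    rw [div_eq_inv_mul]
    exact mul_le_mul_of_nonneg_right (inv_anti₀ (hδ0 t ht) (hle t ht)) (hv0 t)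

/-- Time-reversed form of `log_one_add_le_integral_inv_mul`. -/
theorem log_one_add_le_integral_inv_mul' {v δ : ℝ → ℝ} {a b D : ℝ} (hab : a ≤ b) (hD : 0 < D)
    (hv : Continuous v) (hv0 : ∀ t, 0 ≤ v t) (hδ : ContinuousOn δ (Icc a b))
    (hδ0 : ∀ t ∈ Icc a b, 0 < δ t) (hle : ∀ t ∈ Icc a b, δ t ≤ D + ∫ s in t..b, v s) :
    Real.log (1 + (∫ s in a..b, v s) / D) ≤ ∫ t in a..b, (δ t)⁻¹ * v t := by
  have hmem : ∀ t ∈ Icc a b, a + b - t ∈ Icc a b := fun t ht =>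
    ⟨by linarith [ht.2], by linarith [ht.1]⟩
  have h := log_one_add_le_integral_inv_mul (v := fun t => v (a + b - t))
    (δ := fun t => δ (a + b - t)) hab hD (by fun_prop) (fun t => hv0 _)
    (hδ.comp (by fun_prop) hmem) (fun t ht => hδ0 _ (hmem t ht)) (fun t ht => by
      rw [intervalIntegral.integral_comp_sub_left v, add_sub_cancel_left]
      exact hle _ (hmem t ht))
  rw [intervalIntegral.integral_comp_sub_left v,
    intervalIntegral.integral_comp_sub_left (fun t => (δ t)⁻¹ * v t), add_sub_cancel_left,
    add_sub_cancel_right] at h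
  exact h

/-- The quasihyperbolic length of a curve is bounded below by the Euclidean distance of its end
points, relative to their distances to the boundary. -/
theorem log_add_log_le_curveLen {V : Type*} [NormedAddCommGroup V] [NormedSpace ℝ V]
    [CompleteSpace V] (A : Set V) {γ : ℝ → V} (hγ : ContDiffOn ℝ 1 γ (Icc 0 1))
    (hpos : ∀ t ∈ Icc (0:ℝ) 1, 0 < infDist (γ t) A) :
    Real.log (1 + ‖γ 1 - γ 0‖ / (2 * infDist (γ 0) A))
      + Real.log (1 + ‖γ 1 - γ 0‖ / (2 * infDist (γ 1) A))
      ≤ curveLen (fun z => (infDist z A)⁻¹) γ := by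
  have h01 : (0:ℝ) ≤ 1 := zero_le_one
  have hγc : ContinuousOn γ (Icc 0 1) := hγ.continuousOn
  have hdc : ContinuousOn (derivWithin γ (Icc 0 1)) (Icc 0 1) :=
    hγ.continuousOn_derivWithin (uniqueDiffOn_Icc zero_lt_one) le_rfl
  set g : ℝ → V := IccExtend h01 ((Icc (0:ℝ) 1).domRestrict (derivWithin γ (Icc 0 1))) with hg
  have hgc : Continuous g := hdc.domRestrict.Icc_extend'
  have hgeq : ∀ t ∈ Icc (0:ℝ) 1, g t = derivWithin γ (Icc 0 1) t := fun t ht => by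
    rw [hg, IccExtend_of_mem _ _ ht, domRestrict_apply]
  have hder : ∀ t ∈ Ioo (0:ℝ) 1, HasDerivAt γ (g t) t := fun t ht => by
    rw [hgeq t (Ioo_subset_Icc_self ht)]
    exact ((hγ.differentiableOn one_ne_zero t
      (Ioo_subset_Icc_self ht)).hasDerivWithinAt).hasDerivAt (Icc_mem_nhds ht.1 ht.2)
  have hsub : ∀ a b, 0 ≤ a → a ≤ b → b ≤ 1 → ‖γ b - γ a‖ ≤ ∫ t in a..b, ‖g t‖ := by
    intro a b ha hab hb
    rw [← intervalIntegral.integral_eq_sub_of_hasDerivAt_of_le hab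
      (hγc.mono (Icc_subset_Icc ha hb))
      (fun t ht => hder t ⟨ha.trans_lt ht.1, ht.2.trans_le hb⟩) (hgc.intervalIntegrable a b)]
    exact intervalIntegral.norm_integral_le_integral_norm hab
  set δ : ℝ → ℝ := fun t => infDist (γ t) A with hδ
  have hδc : ContinuousOn δ (Icc 0 1) := (continuous_infDist_pt A).comp_continuousOn hγc
  have hlen : curveLen (fun z => (infDist z A)⁻¹) γ = ∫ t in (0:ℝ)..1, (δ t)⁻¹ * ‖g t‖ := by
    unfold curveLen
    apply intervalIntegral.integral_congr_Ioo_of_le h01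
    intro t ht
    simp only [(hder t ht).deriv, hδ]
  obtain ⟨m, hm, hmeq⟩ : ∃ m ∈ Icc (0:ℝ) 1, ‖γ m - γ 0‖ - ‖γ 1 - γ m‖ = 0 := by
    have hc : ContinuousOn (fun m => ‖γ m - γ 0‖ - ‖γ 1 - γ m‖) (Icc 0 1) := by fun_prop
    have := intermediate_value_Icc h01 hc
    exact this ⟨by simp, by simp⟩
  have htri : ‖γ 1 - γ 0‖ ≤ ‖γ 1 - γ m‖ + ‖γ m - γ 0‖ := norm_sub_le_norm_sub_add_norm_sub _ _ _
  have hv0 : ∀ t, 0 ≤ ‖g t‖ := fun t => norm_nonneg _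
  have hs1 : Icc 0 m ⊆ Icc (0:ℝ) 1 := Icc_subset_Icc le_rfl hm.2
  have hs2 : Icc m 1 ⊆ Icc (0:ℝ) 1 := Icc_subset_Icc hm.1 le_rfl
  have hp0 : 0 < δ 0 := hpos 0 ⟨le_rfl, h01⟩
  have hp1 : 0 < δ 1 := hpos 1 ⟨h01, le_rfl⟩
  have i1 := log_one_add_le_integral_inv_mul hm.1 hp0 hgc.norm hv0 (hδc.mono hs1)
    (fun t ht => hpos t (hs1 ht)) (fun t ht => by
      have := hsub 0 t le_rfl ht.1 (hs1 ht).2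
      have h2 := infDist_le_infDist_add_dist (s := A) (x := γ t) (y := γ 0)
      rw [dist_eq_norm] at h2
      simp only [hδ]; linarith)
  have i2 := log_one_add_le_integral_inv_mul' hm.2 hp1 hgc.norm hv0 (hδc.mono hs2)
    (fun t ht => hpos t (hs2 ht)) (fun t ht => by
      have := hsub t 1 (hs2 ht).1 ht.2 le_rfl
      have h2 := infDist_le_infDist_add_dist (s := A) (x := γ t) (y := γ 1)
      rw [dist_comm, dist_eq_norm] at h2
      simp only [hδ]; linarith)
  have hii : ContinuousOn (fun t => (δ t)⁻¹ * ‖g t‖) (Icc 0 1) :=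
    (hδc.inv₀ fun t ht => (hpos t ht).ne').mul hgc.norm.continuousOn
  rw [hlen, ← intervalIntegral.integral_add_adjacent_intervals
    ((hii.mono hs1).intervalIntegrable_of_Icc hm.1) ((hii.mono hs2).intervalIntegrable_of_Icc hm.2)]
  have aux : ∀ D I : ℝ, 0 < D → ‖γ 1 - γ 0‖ / 2 ≤ I →
      Real.log (1 + ‖γ 1 - γ 0‖ / (2 * D)) ≤ Real.log (1 + I / D) := by
    intro D I hD hI
    rw [← div_div]
    have := norm_nonneg (γ 1 - γ 0)
    gcongr
  have j1 := hsub 0 m le_rfl hm.1 hm.2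
  have j2 := hsub m 1 hm.1 hm.2 le_rfl
  exact add_le_add ((aux _ _ hp0 (by linarith)).trans i1) ((aux _ _ hp1 (by linarith)).trans i2)

theorem densityDist_nonneg {V : Type*} [NormedAddCommGroup V] [NormedSpace ℝ V] (S : Set V)
    {ρ : V → ℝ} (hρ : ∀ z, 0 ≤ ρ z) (z w : V) : 0 ≤ densityDist S ρ z w := by
  refine Real.sInf_nonneg ?_
  rintro L ⟨γ, -, -, -, -, rfl⟩
  exact intervalIntegral.integral_nonneg zero_le_one fun t _ =>
    mul_nonneg (hρ _) (norm_nonneg _)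

/-- The function `2 log (r / √(δ(x) δ(y)))`, with `r = |x - y| + δ(x) + δ(y)`, where `δ` is the
distance to `A`. -/
def logCone {V : Type*} [NormedAddCommGroup V] (A : Set V) (x y : V) : ℝ :=
  2 * Real.log (‖x - y‖ + infDist x A + infDist y A)
    - Real.log (infDist x A) - Real.log (infDist y A)

section LogCone

variable {V : Type*} [NormedAddCommGroup V] {A : Set V}

theorem logCone_comm (x y : V) : logCone A x y = logCone A y x := by
  unfold logCone
  rw [norm_sub_rev x y, add_right_comm]
  ring

theorem logCone_triangle {x y z : V} (hx : 0 < infDist x A) (hy : 0 < infDist y A)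
    (hz : 0 < infDist z A) :
    logCone A x y ≤ logCone A x z + logCone A z y + 2 * Real.log 2 := by
  unfold logCone
  have hxz := norm_nonneg (x - z)
  have hzy := norm_nonneg (z - y)
  have hxy := norm_nonneg (x - y)
  have tri : ‖x - y‖ ≤ ‖x - z‖ + ‖z - y‖ := norm_sub_le_norm_sub_add_norm_sub _ _ _
  set a := infDist x A
  set b := infDist y A
  set c := infDist z A
  have key : Real.log ((‖x - y‖ + a + b) * c)
      ≤ Real.log (2 * ((‖x - z‖ + a + c) * (‖z - y‖ + c + b))) := by
    apply Real.log_le_log (by positivity)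
    nlinarith [mul_nonneg hxz hzy, mul_nonneg hxz hz.le, mul_nonneg hzy hz.le,
      mul_pos hx hz, mul_pos hy hz, mul_nonneg hxz hy.le, mul_nonneg hzy hx.le, mul_pos hx hy,
      mul_pos hz hz]
  rw [Real.log_mul (by positivity) (by positivity), Real.log_mul (by positivity) (by positivity),
    Real.log_mul (by positivity) (by positivity)] at key
  linarith

/-- The four-point inequality for `logCone`. -/
theorem logCone_four_point {x y z w : V} (hx : 0 < infDist x A) (hy : 0 < infDist y A)
    (hz : 0 < infDist z A) (hw : 0 < infDist w A) :
    logCone A x y + logCone A z w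
      ≤ max (logCone A x z + logCone A y w) (logCone A x w + logCone A y z)
        + 2 * Real.log 4 := by
  unfold logCone
  have t1 : ‖x - y‖ ≤ ‖x - z‖ + ‖y - z‖ := by
    rw [norm_sub_rev y z]; exact norm_sub_le_norm_sub_add_norm_sub _ _ _
  have t2 : ‖x - y‖ ≤ ‖x - w‖ + ‖y - w‖ := by
    rw [norm_sub_rev y w]; exact norm_sub_le_norm_sub_add_norm_sub _ _ _
  have t3 : ‖z - w‖ ≤ ‖x - z‖ + ‖x - w‖ := by
    rw [norm_sub_rev x z]; exact norm_sub_le_norm_sub_add_norm_sub _ _ _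
  have t4 : ‖z - w‖ ≤ ‖y - z‖ + ‖y - w‖ := by
    rw [norm_sub_rev y z]; exact norm_sub_le_norm_sub_add_norm_sub _ _ _
  have n1 := norm_nonneg (x - y)
  have n2 := norm_nonneg (x - z)
  have n3 := norm_nonneg (x - w)
  have n4 := norm_nonneg (y - z)
  have n5 := norm_nonneg (y - w)
  have n6 := norm_nonneg (z - w)
  set a := infDist x A
  set b := infDist y A
  set c := infDist z A
  set d := infDist w A
  have p1 : 0 < ‖x - y‖ + a + b := by positivity
  have p2 : 0 < ‖x - z‖ + a + c := by positivity
  have p3 : 0 < ‖x - w‖ + a + d := by positivity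
  have p4 : 0 < ‖y - z‖ + b + c := by positivity
  have p5 : 0 < ‖y - w‖ + b + d := by positivity
  have p6 : 0 < ‖z - w‖ + c + d := by positivity
  have s1 : ‖x - y‖ + a + b ≤ (‖x - z‖ + a + c) + (‖y - z‖ + b + c) := by linarith
  have s2 : ‖x - y‖ + a + b ≤ (‖x - w‖ + a + d) + (‖y - w‖ + b + d) := by linarith
  have s3 : ‖z - w‖ + c + d ≤ (‖x - z‖ + a + c) + (‖x - w‖ + a + d) := by linarith
  have s4 : ‖z - w‖ + c + d ≤ (‖y - z‖ + b + c) + (‖y - w‖ + b + d) := by linarith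
  generalize ‖x - y‖ + a + b = r1 at *
  generalize ‖x - z‖ + a + c = r2 at *
  generalize ‖x - w‖ + a + d = r3 at *
  generalize ‖y - z‖ + b + c = r4 at *
  generalize ‖y - w‖ + b + d = r5 at *
  generalize ‖z - w‖ + c + d = r6 at *
  have ptolemy : r1 * r6 ≤ 4 * (r2 * r5) ∨ r1 * r6 ≤ 4 * (r3 * r4) := by
    have bound : ∀ {p q : ℝ}, r1 ≤ 2 * p → r6 ≤ 2 * q → 0 < p → r1 * r6 ≤ 4 * (p * q) := by
      intro p q h1 h6 hp
      calc r1 * r6 ≤ 2 * p * (2 * q) := mul_le_mul h1 h6 p6.le (by positivity)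
        _ = 4 * (p * q) := by ring
    rcases le_total r2 r3 with h23 | h23 <;> rcases le_total r2 r4 with h24 | h24 <;>
      rcases le_total r3 r5 with h35 | h35 <;> rcases le_total r4 r5 with h45 | h45
    all_goals first
      | exact Or.inl (bound (by linarith) (by linarith) p2)
      | exact Or.inl ((bound (p := r5) (q := r2) (by linarith) (by linarith) p5).trans_eq
          (by rw [mul_comm r5]))
      | exact Or.inr (bound (by linarith) (by linarith) p3)
      | exact Or.inr ((bound (p := r4) (q := r3) (by linarith) (by linarith) p4).trans_eq
          (by rw [mul_comm r4]))
  have take_log : ∀ {p q : ℝ}, 0 < p → 0 < q → r1 * r6 ≤ 4 * (p * q) →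
      Real.log r1 + Real.log r6 ≤ Real.log 4 + (Real.log p + Real.log q) := by
    intro p q hp hq h
    rw [← Real.log_mul p1.ne' p6.ne', ← Real.log_mul hp.ne' hq.ne',
      ← Real.log_mul (by norm_num) (by positivity)]
    exact Real.log_le_log (by positivity) h
  rcases ptolemy with h | h
  · have := take_log p2 p5 h
    refine le_trans ?_ (add_le_add_left (le_max_left _ _) _)
    linarith
  · have := take_log p3 p4 h
    refine le_trans ?_ (add_le_add_left (le_max_right _ _) _)
    linarith

end LogCone

/-- The curve from `z` to `w` that climbs to height comparable with `r` in between. -/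
def archCurve (z w : ℂ) (r : ℝ) (t : ℝ) : ℂ :=
  z + ((3 * t ^ 2 - 2 * t ^ 3 : ℝ) : ℂ) * (w - z) + ((3 * r * t * (1 - t) : ℝ) : ℂ) * I

/-- The velocity of `archCurve`. -/
def archVel (z w : ℂ) (r : ℝ) (t : ℝ) : ℂ :=
  ((6 * t * (1 - t) : ℝ) : ℂ) * (w - z) + ((3 * r * (1 - 2 * t) : ℝ) : ℂ) * I

theorem hasDerivAt_archCurve (z w : ℂ) (r t : ℝ) :
    HasDerivAt (archCurve z w r) (archVel z w r t) t := by
  have h1 : HasDerivAt (fun t : ℝ => 3 * t ^ 2 - 2 * t ^ 3) (6 * t * (1 - t)) t := by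
    refine (((hasDerivAt_pow 2 t).const_mul 3).sub
      ((hasDerivAt_pow 3 t).const_mul 2)).congr_deriv ?_
    norm_num
    ring
  have h2 : HasDerivAt (fun t : ℝ => 3 * r * t * (1 - t)) (3 * r * (1 - 2 * t)) t := by
    refine (((hasDerivAt_id t).const_mul (3 * r)).mul
      ((hasDerivAt_id t).const_sub 1)).congr_deriv ?_
    simp only [id]
    ring
  exact ((h1.ofReal_comp.mul_const (w - z)).const_add z).add (h2.ofReal_comp.mul_const I)

theorem contDiff_archCurve (z w : ℂ) (r : ℝ) : ContDiff ℝ 1 (archCurve z w r) := by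
  unfold archCurve
  have h : ContDiff ℝ 1 (fun x : ℝ => (x : ℂ)) := ofRealCLM.contDiff
  have h1 : ContDiff ℝ 1 (fun t : ℝ => 3 * t ^ 2 - 2 * t ^ 3) := by fun_prop
  have h2 : ContDiff ℝ 1 (fun t : ℝ => 3 * r * t * (1 - t)) := by fun_prop
  exact ((contDiff_const.add ((h.comp h1).mul contDiff_const))).add
    ((h.comp h2).mul contDiff_const)

theorem continuous_archVel (z w : ℂ) (r : ℝ) : Continuous (archVel z w r) := by
  unfold archVel
  fun_prop

theorem archCurve_one_sub (z w : ℂ) (r t : ℝ) :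
    archCurve z w r (1 - t) = archCurve w z r t := by
  unfold archCurve
  push_cast
  ring

theorem archVel_one_sub (z w : ℂ) (r t : ℝ) :
    archVel z w r (1 - t) = -archVel w z r t := by
  unfold archVel
  push_cast
  ring

theorem im_archCurve_ge {z w : ℂ} (hz : 0 ≤ z.im) (hw : 0 ≤ w.im) (r : ℝ) {t : ℝ}
    (ht : t ∈ Icc (0:ℝ) 1) : 3 * r * t * (1 - t) ≤ (archCurve z w r t).im := by
  have e : (archCurve z w r t).im
      = (1 - (3 * t ^ 2 - 2 * t ^ 3)) * z.im + (3 * t ^ 2 - 2 * t ^ 3) * w.im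
        + 3 * r * t * (1 - t) := by
    unfold archCurve
    rw [add_im, add_im, im_ofReal_mul, im_ofReal_mul, I_im, sub_im]
    ring
  obtain ⟨h0, h1⟩ := ht
  have s0 : 0 ≤ 3 * t ^ 2 - 2 * t ^ 3 := by
    nlinarith [mul_nonneg (sq_nonneg t) (sub_nonneg.2 h1), sq_nonneg t]
  have s1 : 0 ≤ 1 - (3 * t ^ 2 - 2 * t ^ 3) := by
    nlinarith [mul_nonneg (sq_nonneg (1 - t)) h0, sq_nonneg (1 - t)]
  rw [e]
  have := mul_nonneg s0 hw
  have := mul_nonneg s1 hz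
  linarith

theorem norm_archVel_le {z w : ℂ} {r t : ℝ} (hr : ‖w - z‖ ≤ r) (ht : t ∈ Icc (0:ℝ) (1 / 2)) :
    ‖archVel z w r t‖ ≤ 6 * r * t * (1 - t) + 3 * r * (1 - 2 * t) := by
  obtain ⟨h0, h1⟩ := ht
  have hr0 : 0 ≤ r := (norm_nonneg _).trans hr
  have h2 : 0 ≤ 6 * t * (1 - t) := by nlinarith
  have h3 : 0 ≤ 3 * r * (1 - 2 * t) := mul_nonneg (by linarith) (by linarith)
  refine (norm_add_le _ _).trans ?_
  rw [norm_mul, norm_mul, norm_I, mul_one, norm_real, norm_real, Real.norm_of_nonneg h2,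
    Real.norm_of_nonneg h3]
  have := mul_le_mul_of_nonneg_left hr h2
  linarith

theorem norm_archCurve_sub_le {z w : ℂ} {r t : ℝ} (hr : ‖w - z‖ ≤ r)
    (ht : t ∈ Icc (0:ℝ) (1 / 2)) :
    ‖archCurve z w r t - z‖ ≤ 2 * (3 * r * t * (1 - t)) := by
  obtain ⟨h0, h1⟩ := ht
  have hr0 : 0 ≤ r := (norm_nonneg _).trans hr
  have h2 : 0 ≤ 3 * t ^ 2 - 2 * t ^ 3 := by nlinarith [sq_nonneg t]
  have h3 : 0 ≤ 3 * r * t * (1 - t) :=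
    mul_nonneg (mul_nonneg (by linarith) h0) (by linarith)
  have e : archCurve z w r t - z
      = ((3 * t ^ 2 - 2 * t ^ 3 : ℝ) : ℂ) * (w - z) + ((3 * r * t * (1 - t) : ℝ) : ℂ) * I := by
    unfold archCurve
    ring
  rw [e]
  refine (norm_add_le _ _).trans ?_
  rw [norm_mul, norm_mul, norm_I, mul_one, norm_real, norm_real, Real.norm_of_nonneg h2,
    Real.norm_of_nonneg h3]
  have h4 := mul_le_mul_of_nonneg_left hr h2
  have h5 : 3 * t ^ 2 - 2 * t ^ 3 ≤ 3 * t * (1 - t) := by nlinarith [pow_nonneg h0 3]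
  have := mul_le_mul_of_nonneg_right h5 hr0
  linarith

theorem inv_le_of_le_of_sub_le {a B M : ℝ} (ha : 0 < a) (hB : 0 ≤ B) (hM : 0 < M) (h1 : B ≤ M)
    (h2 : a - 2 * B ≤ M) : M⁻¹ ≤ 1 / (a + B) + 4 * a / (a + B) ^ 2 := by
  have hp : 0 < a + B := by linarith
  have e : 1 / (a + B) + 4 * a / (a + B) ^ 2 = (5 * a + B) / (a + B) ^ 2 := by
    field_simp
    ring
  rw [e, inv_eq_one_div, div_le_div_iff₀ hM (by positivity), one_mul]
  rcases le_total a (3 * B) with h | h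
  · nlinarith [mul_le_mul_of_nonneg_right h1 (show 0 ≤ 5 * a + B by linarith)]
  · nlinarith [mul_le_mul_of_nonneg_right h2 (show 0 ≤ 5 * a + B by linarith),
      mul_nonneg (sub_nonneg.2 h) (show 0 ≤ 4 * a + B by linarith)]

section UpperHalf

variable {A : Set ℂ}

theorem im_le_infDist (hA : A.Nonempty) (hreal : ∀ a ∈ A, a.im = 0) (z : ℂ) :
    z.im ≤ infDist z A := by
  refine (le_infDist hA).2 fun a ha => ?_
  rw [dist_eq_norm]
  calc z.im = (z - a).im := by rw [sub_im, hreal a ha, sub_zero]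
    _ ≤ ‖z - a‖ := im_le_norm _

theorem infDist_archCurve_pos (hA : A.Nonempty) (hreal : ∀ a ∈ A, a.im = 0) {z w : ℂ}
    (hz : 0 ≤ z.im) (hw : 0 ≤ w.im) (hzA : 0 < infDist z A) (hwA : 0 < infDist w A) {r : ℝ}
    (hr : 0 < r) {t : ℝ} (ht : t ∈ Icc (0:ℝ) 1) : 0 < infDist (archCurve z w r t) A := by
  rcases ht.1.eq_or_lt with rfl | h0
  · simpa [archCurve] using hzA
  rcases ht.2.eq_or_lt with rfl | h1
  · have : archCurve z w r 1 = w := by unfold archCurve; norm_num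
    rwa [this]
  · exact lt_of_lt_of_le (mul_pos (by positivity) (by linarith))
      ((im_archCurve_ge hz hw r ht).trans (im_le_infDist hA hreal _))

theorem integral_half_archCurve_le (hA : A.Nonempty) (hreal : ∀ a ∈ A, a.im = 0) {z w : ℂ}
    (hz : 0 ≤ z.im) (hw : 0 ≤ w.im) (hzA : 0 < infDist z A) (hwA : 0 < infDist w A) {r : ℝ}
    (hr : ‖w - z‖ ≤ r) (har : infDist z A ≤ r) :
    ∫ t in (0:ℝ)..(1 / 2), (infDist (archCurve z w r t) A)⁻¹ * ‖archVel z w r t‖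
      ≤ Real.log (2 * r) - Real.log (infDist z A) + 5 := by
  have hr0 : 0 < r := hzA.trans_le har
  have hhalf : (0:ℝ) ≤ 1 / 2 := by norm_num
  have hsub : Icc (0:ℝ) (1 / 2) ⊆ Icc 0 1 := Icc_subset_Icc le_rfl (by norm_num)
  have hpos : ∀ t ∈ Icc (0:ℝ) (1 / 2), 0 < infDist (archCurve z w r t) A := fun t ht =>
    infDist_archCurve_pos hA hreal hz hw hzA hwA hr0 (hsub ht)
  set a := infDist z A with ha
  have hB : ∀ t ∈ Icc (0:ℝ) (1 / 2), 0 ≤ 3 * r * t * (1 - t) := fun t ht =>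
    mul_nonneg (mul_nonneg (by positivity) ht.1) (by linarith [ht.2])
  have hder : ∀ t ∈ Icc (0:ℝ) (1 / 2),
      HasDerivAt (fun t => Real.log (a + 3 * r * t * (1 - t))
          - 4 * a * (a + 3 * r * t * (1 - t))⁻¹ + 2 * t)
        (3 * r * (1 - 2 * t) * (1 / (a + 3 * r * t * (1 - t))
          + 4 * a / (a + 3 * r * t * (1 - t)) ^ 2) + 2) t := by
    intro t ht
    have hne : a + 3 * r * t * (1 - t) ≠ 0 := by linarith [hB t ht]
    have h2 : HasDerivAt (fun t : ℝ => a + 3 * r * t * (1 - t)) (3 * r * (1 - 2 * t)) t := by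
      refine ((((hasDerivAt_id t).const_mul (3 * r)).mul
        ((hasDerivAt_id t).const_sub 1)).const_add a).congr_deriv ?_
      simp only [id]
      ring
    refine (((h2.log hne).sub ((h2.inv hne).const_mul (4 * a))).add
      ((hasDerivAt_id t).const_mul 2)).congr_deriv ?_
    field_simp
    ring
  have hint : IntervalIntegrable (fun t => 3 * r * (1 - 2 * t) * (1 / (a + 3 * r * t * (1 - t))
          + 4 * a / (a + 3 * r * t * (1 - t)) ^ 2) + 2) MeasureTheory.volume 0 (1 / 2) := by
    apply ContinuousOn.intervalIntegrable_of_Icc hhalf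
    have hne : ∀ t ∈ Icc (0:ℝ) (1 / 2), a + 3 * r * t * (1 - t) ≠ 0 := fun t ht => by
      linarith [hB t ht]
    have hne2 : ∀ t ∈ Icc (0:ℝ) (1 / 2), (a + 3 * r * t * (1 - t)) ^ 2 ≠ 0 := fun t ht =>
      pow_ne_zero 2 (hne t ht)
    have c1 : ContinuousOn (fun t => 1 / (a + 3 * r * t * (1 - t))) (Icc 0 (1 / 2)) :=
      continuousOn_const.div (by fun_prop) hne
    have c2 : ContinuousOn (fun t => 4 * a / (a + 3 * r * t * (1 - t)) ^ 2) (Icc 0 (1 / 2)) :=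
      continuousOn_const.div (by fun_prop) hne2
    fun_prop
  have hmono : ∫ t in (0:ℝ)..(1 / 2), (infDist (archCurve z w r t) A)⁻¹ * ‖archVel z w r t‖
      ≤ ∫ t in (0:ℝ)..(1 / 2), (3 * r * (1 - 2 * t) * (1 / (a + 3 * r * t * (1 - t))
          + 4 * a / (a + 3 * r * t * (1 - t)) ^ 2) + 2) := by
    apply intervalIntegral.integral_mono_on hhalf _ hint
    · intro t ht
      have hM := hpos t ht
      have h1 : 3 * r * t * (1 - t) ≤ infDist (archCurve z w r t) A :=
        (im_archCurve_ge hz hw r (hsub ht)).trans (im_le_infDist hA hreal _)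
      have h2 : a - 2 * (3 * r * t * (1 - t)) ≤ infDist (archCurve z w r t) A := by
        have h3 := infDist_le_infDist_add_dist (s := A) (x := z) (y := archCurve z w r t)
        rw [dist_comm, dist_eq_norm] at h3
        linarith [norm_archCurve_sub_le hr ht]
      have h4 := inv_le_of_le_of_sub_le hzA (hB t ht) hM h1 h2
      have h5 : 0 ≤ 3 * r * (1 - 2 * t) := mul_nonneg (by positivity) (by linarith [ht.2])
      calc (infDist (archCurve z w r t) A)⁻¹ * ‖archVel z w r t‖
          ≤ (infDist (archCurve z w r t) A)⁻¹
              * (6 * r * t * (1 - t) + 3 * r * (1 - 2 * t)) := by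
            gcongr
            exact norm_archVel_le hr ht
        _ = 3 * r * (1 - 2 * t) * (infDist (archCurve z w r t) A)⁻¹
              + 2 * ((3 * r * t * (1 - t)) / infDist (archCurve z w r t) A) := by ring
        _ ≤ _ := by
            refine add_le_add (mul_le_mul_of_nonneg_left h4 h5) ?_
            have := div_le_one_of_le₀ h1 hM.le
            linarith
    · apply ContinuousOn.intervalIntegrable_of_Icc hhalf
      refine ContinuousOn.mul (ContinuousOn.inv₀ ?_ fun t ht => (hpos t ht).ne')
        (continuous_archVel z w r).norm.continuousOn
      exact ((continuous_infDist_pt A).comp (contDiff_archCurve z w r).continuous).continuousOn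
  refine hmono.trans ?_
  rw [intervalIntegral.integral_eq_sub_of_hasDerivAt (fun t ht => hder t (by
    rwa [uIcc_of_le hhalf] at ht)) hint]
  have hlog : Real.log (a + 3 * r * (1 / 2) * (1 - 1 / 2)) ≤ Real.log (2 * r) :=
    Real.log_le_log (by positivity) (by linarith)
  have hinv : 0 ≤ 4 * a * (a + 3 * r * (1 / 2) * (1 - 1 / 2))⁻¹ := by positivity
  have h0 : 4 * a * (a + 3 * r * 0 * (1 - 0))⁻¹ = 4 := by
    field_simp
    ring
  have h0' : a + 3 * r * 0 * (1 - 0) = a := by ring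
  rw [h0, h0']
  linarith

theorem curveLen_archCurve_le (hA : A.Nonempty) (hreal : ∀ a ∈ A, a.im = 0) {z w : ℂ}
    (hz : 0 ≤ z.im) (hw : 0 ≤ w.im) (hzA : 0 < infDist z A) (hwA : 0 < infDist w A) :
    curveLen (fun x => (infDist x A)⁻¹)
        (archCurve z w (‖z - w‖ + infDist z A + infDist w A))
      ≤ logCone A z w + 2 * Real.log 2 + 10 := by
  set r := ‖z - w‖ + infDist z A + infDist w A with hr
  have hn := norm_nonneg (z - w)
  have hr0 : 0 < r := by positivity
  have hpos : ∀ t ∈ Icc (0:ℝ) 1, 0 < infDist (archCurve z w r t) A := fun t ht =>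
    infDist_archCurve_pos hA hreal hz hw hzA hwA hr0 ht
  set f : ℂ → ℂ → ℝ → ℝ := fun z w t => (infDist (archCurve z w r t) A)⁻¹ * ‖archVel z w r t‖
    with hf
  have hcont : ContinuousOn (f z w) (Icc 0 1) :=
    ((((continuous_infDist_pt A).comp (contDiff_archCurve z w r).continuous).continuousOn).inv₀
      fun t ht => (hpos t ht).ne').mul (continuous_archVel z w r).norm.continuousOn
  have hrev : ∀ t, f z w t = f w z (1 - t) := fun t => by
    simp only [hf, archCurve_one_sub, archVel_one_sub, norm_neg]
  have e : curveLen (fun x => (infDist x A)⁻¹) (archCurve z w r)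
      = (∫ t in (0:ℝ)..(1 / 2), f z w t) + ∫ t in (0:ℝ)..(1 / 2), f w z t := by
    have h2 : ∫ t in (0:ℝ)..(1 / 2), f w z t = ∫ t in (1 / 2 : ℝ)..1, f z w t := by
      simp only [hrev]
      rw [intervalIntegral.integral_comp_sub_left (f w z)]
      norm_num
    rw [h2, intervalIntegral.integral_add_adjacent_intervals
      ((hcont.mono (Icc_subset_Icc le_rfl (by norm_num))).intervalIntegrable_of_Icc (by norm_num))
      ((hcont.mono (Icc_subset_Icc (by norm_num) le_rfl)).intervalIntegrable_of_Icc (by norm_num))]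
    simp only [curveLen, (hasDerivAt_archCurve z w r _).deriv, hf]
  rw [e]
  have i1 := integral_half_archCurve_le hA hreal hz hw hzA hwA (r := r)
    (by rw [norm_sub_rev]; linarith) (by linarith)
  have i2 := integral_half_archCurve_le hA hreal hw hz hwA hzA (r := r)
    (by linarith) (by linarith)
  have hlog : Real.log (2 * r) = Real.log 2 + Real.log r := Real.log_mul two_ne_zero hr0.ne'
  unfold logCone
  rw [← hr]
  linarith

theorem logCone_le_log_add_log {V : Type*} [NormedAddCommGroup V] {A : Set V} {z w : V}
    (hz : 0 < infDist z A) (hw : 0 < infDist w A) :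
    logCone A z w ≤ Real.log (1 + ‖w - z‖ / (2 * infDist z A))
      + Real.log (1 + ‖w - z‖ / (2 * infDist w A)) + 4 * Real.log 2 := by
  have h1 := infDist_le_infDist_add_dist (s := A) (x := z) (y := w)
  have h2 := infDist_le_infDist_add_dist (s := A) (x := w) (y := z)
  rw [dist_eq_norm] at h1 h2
  unfold logCone
  rw [norm_sub_rev z w] at *
  have hn := norm_nonneg (w - z)
  set a := infDist z A
  set b := infDist w A
  set d := ‖w - z‖
  have hlog : ∀ x y : ℝ, 0 < x → d + a + b ≤ 2 * (2 * x + d) →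
      Real.log (d + a + b) - Real.log x ≤ Real.log (1 + d / (2 * x)) + 2 * Real.log 2 := by
    intro x _ hx h
    have e : 1 + d / (2 * x) = (2 * x + d) / (2 * x) := by field_simp
    have h3 := Real.log_le_log (by positivity) h
    rw [Real.log_mul two_ne_zero (by positivity)] at h3
    rw [e, Real.log_div (by positivity) (by positivity), Real.log_mul two_ne_zero hx.ne']
    linarith
  have := hlog a 0 hz (by linarith)
  have := hlog b 0 hw (by linarith)
  linarith

/-- On the closed upper half plane minus a set `A` of reals, the inner quasihyperbolic distance
agrees with `logCone` up to a universal additive constant. -/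
theorem abs_densityDist_sub_logCone_le (hAc : IsClosed A) (hA : A.Nonempty)
    (hreal : ∀ a ∈ A, a.im = 0) {z w : ℂ} (hz : z ∈ Aᶜ ∩ {z : ℂ | 0 ≤ z.im})
    (hw : w ∈ Aᶜ ∩ {z : ℂ | 0 ≤ z.im}) :
    |densityDist (Aᶜ ∩ {z : ℂ | 0 ≤ z.im}) (qhDensity Aᶜ) z w - logCone A z w| ≤ 12 := by
  have hpos : ∀ x ∈ Aᶜ ∩ {z : ℂ | 0 ≤ z.im}, 0 < infDist x A := fun x hx =>
    (hAc.notMem_iff_infDist_pos hA).1 hx.1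
  have hρ : qhDensity Aᶜ = fun z => (infDist z A)⁻¹ := by
    unfold qhDensity
    rw [compl_compl]
  rw [hρ]
  have hlog2 := Real.log_two_lt_d9
  have lower : ∀ L ∈ { L | ∃ γ : ℝ → ℂ, ContDiffOn ℝ 1 γ (Icc 0 1) ∧ γ 0 = z ∧ γ 1 = w ∧
      (∀ t ∈ Icc (0:ℝ) 1, γ t ∈ Aᶜ ∩ {z : ℂ | 0 ≤ z.im}) ∧
        L = curveLen (fun z => (infDist z A)⁻¹) γ }, logCone A z w - 12 ≤ L := by
    rintro L ⟨γ, hγ, rfl, rfl, hmem, rfl⟩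
    have := log_add_log_le_curveLen A hγ fun t ht => hpos _ (hmem t ht)
    have := logCone_le_log_add_log (hpos _ hz) (hpos _ hw)
    linarith
  have hn := norm_nonneg (z - w)
  have hr0 : 0 < ‖z - w‖ + infDist z A + infDist w A := by
    have := hpos z hz
    have := hpos w hw
    positivity
  have arch : curveLen (fun z => (infDist z A)⁻¹)
      (archCurve z w (‖z - w‖ + infDist z A + infDist w A)) ∈
      { L | ∃ γ : ℝ → ℂ, ContDiffOn ℝ 1 γ (Icc 0 1) ∧ γ 0 = z ∧ γ 1 = w ∧
      (∀ t ∈ Icc (0:ℝ) 1, γ t ∈ Aᶜ ∩ {z : ℂ | 0 ≤ z.im}) ∧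
        L = curveLen (fun z => (infDist z A)⁻¹) γ } := by
    refine ⟨_, (contDiff_archCurve z w _).contDiffOn, by simp [archCurve], by
      unfold archCurve; norm_num, fun t ht => ⟨?_, ?_⟩, rfl⟩
    · exact (hAc.notMem_iff_infDist_pos hA).2
        (infDist_archCurve_pos hA hreal hz.2 hw.2 (hpos z hz) (hpos w hw) hr0 ht)
    · exact le_trans (mul_nonneg (mul_nonneg (by positivity) ht.1) (by linarith [ht.2]))
        (im_archCurve_ge hz.2 hw.2 _ ht)
  have up := curveLen_archCurve_le hA hreal hz.2 hw.2 (hpos z hz) (hpos w hw)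
  have h1 := csInf_le ⟨_, lower⟩ arch
  have h2 := le_csInf ⟨_, arch⟩ lower
  unfold densityDist
  rw [abs_le]
  constructor <;> linarith

end UpperHalf

/-- In a space whose distance is within a bounded error of `logCone`, points at comparable
distance from the common end point of two geodesics stay close, up to the Gromov product. -/
theorem logCone_le_of_le_gromov_product {V : Type*} [NormedAddCommGroup V] {A : Set V}
    {x y z p q : V} {L b c t : ℝ} (hx : 0 < infDist x A) (hy : 0 < infDist y A)
    (hz : 0 < infDist z A) (hp : 0 < infDist p A) (hq : 0 < infDist q A)
    (hxy : |L - logCone A x y| ≤ 12) (hxz : |b - logCone A x z| ≤ 12)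
    (hyz : |c - logCone A y z| ≤ 12) (hxp : |t - logCone A x p| ≤ 12)
    (hpy : |L - t - logCone A p y| ≤ 12) (hxq : |min t b - logCone A x q| ≤ 12)
    (hqz : |b - min t b - logCone A q z| ≤ 12) (ht : 2 * t ≤ b + L - c) :
    logCone A p q ≤ 188 := by
  have hlog2 := Real.log_two_lt_d9
  have hlog4 : Real.log 4 = 2 * Real.log 2 := by
    rw [show (4:ℝ) = 2 ^ 2 by norm_num, Real.log_pow]
    norm_num
  have tri := logCone_triangle hx hy hz
  have f1 := logCone_four_point hp hq hx hy
  have f2 := logCone_four_point hq hy hx hz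
  rw [hlog4] at f1 f2
  rw [logCone_comm p x, logCone_comm q x] at f1
  rw [logCone_comm q x, logCone_comm y x] at f2
  rw [logCone_comm z y] at tri
  rw [abs_le] at *
  obtain ⟨_, _⟩ := hxy
  obtain ⟨_, _⟩ := hxz
  obtain ⟨_, _⟩ := hyz
  obtain ⟨_, _⟩ := hxp
  obtain ⟨_, _⟩ := hpy
  obtain ⟨_, _⟩ := hxq
  obtain ⟨_, _⟩ := hqz
  have hs1 : min t b ≤ t := min_le_left _ _
  have hs2 : t - 20 ≤ min t b := le_min (by linarith) (by linarith)
  generalize min t b = s at *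
  rcases max_choice (logCone A x q + logCone A y z) (logCone A q z + logCone A x y)
    with h | h <;> rw [h] at f2 <;>
  rcases max_choice (logCone A x p + logCone A q y) (logCone A p y + logCone A x q)
    with h' | h' <;> rw [h'] at f1 <;> linarith

/-- Lemma 3.1, quasihyperbolic case: the closed upper half `D` of `D₀ = ℂ \ E`, with the
inner metric obtained by restricting the quasihyperbolic metric of `D₀`, is Gromov
`δ`-hyperbolic with a universal constant `δ`. -/
theorem upper_half_denjoy_qh_hyperbolic :
    ∃ δ : ℝ, 0 ≤ δ ∧
      ∀ (E : Set ℝ), IsClosed E → E.Nonempty →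
        ∀ D₀ D : Set ℂ,
          D₀ = ((fun x : ℝ => (x : ℂ)) '' E)ᶜ →
          D = D₀ ∩ {z : ℂ | 0 ≤ z.im} →
          GromovHyperbolicWith D (densityDist D (qhDensity D₀)) δ := by
  refine ⟨200, by norm_num, ?_⟩
  rintro E hE hne D₀ D rfl rfl
  set A : Set ℂ := (fun x : ℝ => (x : ℂ)) '' E with hAdef
  have hAc : IsClosed A := isometry_ofReal.isClosedEmbedding.isClosedMap E hE
  have hA : A.Nonempty := hne.image _
  have hreal : ∀ a ∈ A, a.im = 0 := by
    rintro _ ⟨x, -, rfl⟩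
    exact ofReal_im x
  set S : Set ℂ := Aᶜ ∩ {z : ℂ | 0 ≤ z.im}
  have hpos : ∀ x ∈ S, 0 < infDist x A := fun x hx => (hAc.notMem_iff_infDist_pos hA).1 hx.1
  have happrox : ∀ {z w : ℂ}, z ∈ S → w ∈ S →
      |densityDist S (qhDensity Aᶜ) z w - logCone A z w| ≤ 12 := fun hz hw =>
    abs_densityDist_sub_logCone_le hAc hA hreal hz hw
  have hd0 : ∀ z w, 0 ≤ densityDist S (qhDensity Aᶜ) z w :=
    densityDist_nonneg S fun z => inv_nonneg.2 infDist_nonneg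
  generalize densityDist S (qhDensity Aᶜ) = d at happrox hd0
  intro x hx y hy z hz gxy gxz gzy ⟨hxy0, hxy1, hxyS, hxyd⟩ ⟨hxz0, hxz1, hxzS, hxzd⟩
    ⟨hzy0, hzy1, hzyS, hzyd⟩ t ht
  have mem0 : ∀ {u : ℝ}, 0 ≤ u → (0:ℝ) ∈ Icc 0 u := fun h => ⟨le_rfl, h⟩
  have mem1 : ∀ {u : ℝ}, 0 ≤ u → u ∈ Icc 0 u := fun h => ⟨h, le_rfl⟩
  have hL := hd0 x y
  have hb := hd0 x z
  have hc := hd0 z y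
  have hpS := hxyS t ht
  have hxp : d x (gxy t) = t := by
    have := hxyd 0 (mem0 hL) t ht
    rwa [hxy0, zero_sub, abs_neg, abs_of_nonneg ht.1] at this
  have hpy : d (gxy t) y = d x y - t := by
    have := hxyd t ht _ (mem1 hL)
    rwa [hxy1, abs_sub_comm, abs_of_nonneg (sub_nonneg.2 ht.2)] at this
  have axy := happrox hx hy
  have axz := happrox hx hz
  have azy := happrox hz hy
  have axp := happrox hx hpS
  have apy := happrox hpS hy
  rw [hxp] at axp
  rw [hpy] at apy
  have hclose : ∀ q ∈ S, logCone A (gxy t) q ≤ 188 → d (gxy t) q ≤ 200 := fun q hq h => by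
    linarith [(abs_le.1 (happrox hpS hq)).2]
  rcases le_total (2 * t) (d x z + d x y - d z y) with h | h
  · have hs : min t (d x z) ∈ Icc 0 (d x z) := ⟨le_min ht.1 hb, min_le_right _ _⟩
    have hqS := hxzS _ hs
    refine ⟨_, Or.inl ⟨_, hs, rfl⟩, hclose _ hqS ?_⟩
    have hxq : d x (gxz (min t (d x z))) = min t (d x z) := by
      have := hxzd 0 (mem0 hb) _ hs
      rwa [hxz0, zero_sub, abs_neg, abs_of_nonneg hs.1] at this
    have hqz : d (gxz (min t (d x z))) z = d x z - min t (d x z) := by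
      have := hxzd _ hs _ (mem1 hb)
      rwa [hxz1, abs_sub_comm, abs_of_nonneg (sub_nonneg.2 hs.2)] at this
    have axq := happrox hx hqS
    have aqz := happrox hqS hz
    rw [hxq] at axq
    rw [hqz] at aqz
    rw [logCone_comm z y] at azy
    exact logCone_le_of_le_gromov_product (hpos _ hx) (hpos _ hy) (hpos _ hz) (hpos _ hpS)
      (hpos _ hqS) axy axz azy axp apy axq aqz h
  · set s := min (d x y - t) (d z y) with hsdef
    have hs0 : 0 ≤ s := le_min (sub_nonneg.2 ht.2) hc
    have hs1 : s ≤ d z y := min_le_right _ _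
    have hs : d z y - s ∈ Icc 0 (d z y) := ⟨sub_nonneg.2 hs1, sub_le_self _ hs0⟩
    have hqS := hzyS _ hs
    refine ⟨_, Or.inr ⟨_, hs, rfl⟩, hclose _ hqS ?_⟩
    have hqy : d (gzy (d z y - s)) y = s := by
      have := hzyd _ hs _ (mem1 hc)
      rwa [hzy1, abs_sub_comm, sub_sub_cancel, abs_of_nonneg hs0] at this
    have hzq : d z (gzy (d z y - s)) = d z y - s := by
      have := hzyd 0 (mem0 hc) _ hs
      rwa [hzy0, zero_sub, abs_neg, abs_of_nonneg hs.1] at this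
    have ayq := happrox hqS hy
    have aqz := happrox hz hqS
    rw [hqy, logCone_comm] at ayq
    rw [hzq, logCone_comm] at aqz
    rw [logCone_comm] at axy azy apy
    refine logCone_le_of_le_gromov_product (hpos _ hy) (hpos _ hx) (hpos _ hz) (hpos _ hpS)
      (hpos _ hqS) axy azy axz apy ?_ ayq aqz (by linarith)
    rwa [sub_sub_cancel, logCone_comm]

end
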